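/- arXiv:1410.0212 — 3 statements merged into one kernel-verified Lean document; each statement's English description precedes it below -/
import Mathlib

section
/- Let n ≥ 1 and m be integers with gcd(m, n) = 1, and let ζ = exp(2πi·m/n) ∈ ℂ. Then the sum over k from 1 to n−1 of ζ^k/(1 − ζ^k)² equals −(n² − 1)/12. -/
/-- Closed form of the generating polynomial of the sequence `j * (c - j)`. -/
theorem sub_one_pow_three_mul_sum_mul_sub_mul_pow {R : Type*} [CommRing R] (c z : R) (N : ℕ) :
    (z - 1) ^ 3 * ∑ j ∈ Finset.range N, (j : R) * (c - j) * z ^ j =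
      c * (z - 1) * (N * z ^ N * (z - 1) - z * (z ^ N - 1)) -
        (N ^ 2 * z ^ N * (z - 1) ^ 2 - 2 * z * (N * z ^ N * (z - 1) - z * (z ^ N - 1)) -
          z * (z - 1) * (z ^ N - 1)) := by
  induction N with
  | zero => simp
  | succ N ih =>
    rw [Finset.sum_range_succ, mul_add, ih]
    push_cast
    ring

theorem div_one_sub_sq_eq_sum_of_pow_eq_one {K : Type*} [Field K] [CharZero K] {z : K} {n : ℕ}
    (hn : n ≠ 0) (hz : z ^ n = 1) (hz1 : z ≠ 1) :
    z / (1 - z) ^ 2 = (∑ j ∈ Finset.range n, (j : K) * (n - j) * z ^ j) / (2 * n) := by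
  have hsub : z - 1 ≠ 0 := sub_ne_zero.2 hz1
  have hsub' : 1 - z ≠ 0 := sub_ne_zero.2 hz1.symm
  have hn' : (n : K) ≠ 0 := Nat.cast_ne_zero.2 hn
  have h := sub_one_pow_three_mul_sum_mul_sub_mul_pow (n : K) z n
  rw [hz] at h
  rw [div_eq_div_iff (pow_ne_zero 2 hsub') (by simpa using hn')]
  apply mul_left_cancel₀ hsub
  linear_combination -h

theorem sum_Ico_pow_eq_neg_one_of_pow_eq_one {K : Type*} [Field K] {z : K} {n : ℕ}
    (hn : 1 ≤ n) (hz : z ^ n = 1) (hz1 : z ≠ 1) : ∑ k ∈ Finset.Ico 1 n, z ^ k = -1 := by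
  rw [geom_sum_Ico hz1 hn, hz, pow_one, div_eq_iff (sub_ne_zero.2 hz1)]
  ring

theorem sum_range_mul_sub {K : Type*} [Field K] [CharZero K] (c : K) (N : ℕ) :
    ∑ j ∈ Finset.range N, (j : K) * (c - j) =
      N * (N - 1) * (3 * c - (2 * N - 1)) / 6 := by
  induction N with
  | zero => simp
  | succ N ih =>
    rw [Finset.sum_range_succ, ih]
    push_cast
    ring

theorem IsPrimitiveRoot.sum_pow_div_one_sub_pow_sq {K : Type*} [Field K] [CharZero K] {ζ : K}
    {n : ℕ} (h : IsPrimitiveRoot ζ n) (hn : 1 ≤ n) :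
    ∑ k ∈ Finset.Ico 1 n, ζ ^ k / (1 - ζ ^ k) ^ 2 = -(((n : K) ^ 2 - 1) / 12) := by
  have hn0 : n ≠ 0 := by omega
  have hn' : (n : K) ≠ 0 := Nat.cast_ne_zero.2 hn0
  have hpow (k : ℕ) : (ζ ^ k) ^ n = 1 := by rw [pow_right_comm, h.pow_eq_one, one_pow]
  calc
    _ = ∑ k ∈ Finset.Ico 1 n,
        (∑ j ∈ Finset.range n, (j : K) * (n - j) * (ζ ^ k) ^ j) / (2 * n) := by
      refine Finset.sum_congr rfl fun k hk => ?_
      rw [Finset.mem_Ico] at hk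
      exact div_one_sub_sq_eq_sum_of_pow_eq_one hn0 (hpow k)
        (h.pow_ne_one_of_pos_of_lt (by omega) hk.2)
    _ = (∑ j ∈ Finset.range n, (j : K) * (n - j) * ∑ k ∈ Finset.Ico 1 n, (ζ ^ j) ^ k) /
        (2 * n) := by
      rw [← Finset.sum_div, Finset.sum_comm]
      simp_rw [Finset.mul_sum, pow_right_comm]
    _ = (∑ j ∈ Finset.range n, -((j : K) * (n - j))) / (2 * n) := by
      congr 1
      refine Finset.sum_congr rfl fun j hj => ?_
      rcases eq_or_ne j 0 with rfl | hj0
      · simp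
      · rw [sum_Ico_pow_eq_neg_one_of_pow_eq_one hn (hpow j)
          (h.pow_ne_one_of_pos_of_lt hj0 (Finset.mem_range.1 hj)), mul_neg_one]
    _ = _ := by
      rw [Finset.sum_neg_distrib, sum_range_mul_sub]
      field_simp
      ring

/-- The classical Dedekind-sum evaluation: for `n ≥ 1`, `gcd(m,n) = 1` and
`ζ = exp(2πi·m/n)`, one has `∑_{k=1}^{n-1} ζ^k/(1-ζ^k)^2 = -(n²-1)/12`. -/
theorem dedekind_sum_eval (n : ℕ) (hn : 1 ≤ n) (m : ℤ) (hgcd : Int.gcd m (n : ℤ) = 1)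
    (ζ : ℂ) (hζ : ζ = Complex.exp (2 * Real.pi * Complex.I * (m : ℂ) / (n : ℂ))) :
    ∑ k ∈ Finset.Ico 1 n, ζ ^ k / (1 - ζ ^ k) ^ 2 = -(((n : ℂ) ^ 2 - 1) / 12) := by
  have hprim : IsPrimitiveRoot ζ n := by
    have h := (Complex.isPrimitiveRoot_exp n (by omega)).zpow_of_gcd_eq_one m hgcd
    rw [← Complex.exp_int_mul] at h
    have harg : 2 * Real.pi * Complex.I * (m : ℂ) / (n : ℂ) =
        m * (2 * Real.pi * Complex.I / n) := by ring
    rwa [hζ, harg]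
  exact hprim.sum_pow_div_one_sub_pow_sq hn
end

section
/- Let Γ be a nontrivial finite abelian group and χ₁, χ₂, χ₃ : Γ → ℂ* group homomorphisms such that χ₁(g)χ₂(g)χ₃(g) = 1 for all g ∈ Γ, such that ker χ₁ ∩ ker χ₂ ∩ ker χ₃ = {1}, and such that each χ_k is nontrivial. Assume moreover that Γ = ker χ₁ ∪ ker χ₂ ∪ ker χ₃, i.e. every g ∈ Γ satisfies χ_k(g) = 1 for some k. Then |Γ| = 4 and the injective homomorphism g ↦ (χ₁(g), χ₂(g), χ₃(g)) maps Γ bijectively onto the set {(1,1,1), (−1,−1,1), (−1,1,−1), (1,−1,−1)}. -/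
/-- If the kernels of three homomorphisms cover the group and the last two are nontrivial, then some
element of the kernel of the first is outside the kernel of the second. -/
theorem exists_mem_ker_notMem_ker_of_cover {G A : Type*} [Group G] [Group A]
    {a b c : G →* A} (hb : b ≠ 1) (hc : c ≠ 1)
    (hcover : ∀ g, a g = 1 ∨ b g = 1 ∨ c g = 1) : ∃ g, a g = 1 ∧ b g ≠ 1 := by
  obtain ⟨x, hx⟩ := DFunLike.ne_iff.mp hb
  obtain ⟨y, hy⟩ := DFunLike.ne_iff.mp hc
  rw [MonoidHom.one_apply] at hx hy
  by_contra! h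
  have hcx : c x = 1 := by grind
  have hby : b y = 1 := by
    have hay := h y
    grind
  have hbxy : b (x * y) = b x := by rw [map_mul, hby, mul_one]
  have hcxy : c (x * y) = c y := by rw [map_mul, hcx, one_mul]
  have := hcover (x * y)
  have := h (x * y)
  grind

/-- If the kernels of three nontrivial characters with product `1` cover the group, then on the
kernel of the first the second takes only the values `1` and `-1`. -/
theorem eq_one_or_eq_neg_one_of_cover {G R : Type*} [Group G] [CommRing R] [NoZeroDivisors R]
    {a b c : G →* Rˣ} (hprod : ∀ g, a g * b g * c g = 1) (ha : a ≠ 1) (hc : c ≠ 1)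
    (hcover : ∀ g, a g = 1 ∨ b g = 1 ∨ c g = 1) {g : G} (hg : a g = 1) :
    b g = 1 ∨ b g = -1 := by
  obtain ⟨h, hbh, hah⟩ := exists_mem_ker_notMem_ker_of_cover (a := b) (b := a) (c := c) ha hc
    (fun g => or_left_comm.mp (hcover g))
  have key : ∀ k, a k = 1 → b k ≠ 1 → a h * b k = 1 := by
    intro k hak hbk
    have hakh : a (k * h) = a h := by rw [map_mul, hak, one_mul]
    have hbkh : b (k * h) = b k := by rw [map_mul, hbh, mul_one]
    have hckh : c (k * h) = 1 := by
      have := hcover (k * h)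
      grind
    simpa [hakh, hbkh, hckh] using hprod (k * h)
  by_cases hbg : b g = 1
  · exact Or.inl hbg
  · have h₁ := key g hg hbg
    have h₂ := key g⁻¹ (by simp [hg]) (by simpa using hbg)
    rw [map_inv] at h₂
    exact (Units.inv_eq_self_iff _).mp (mul_left_cancel (h₂.trans h₁.symm))

/-- Classification of the exceptional case: if `Γ` is a nontrivial finite abelian group
with nontrivial characters `χ₁, χ₂, χ₃ : Γ → ℂ*` satisfying `χ₁χ₂χ₃ = 1`,
`ker χ₁ ∩ ker χ₂ ∩ ker χ₃ = {1}` and `Γ = ker χ₁ ∪ ker χ₂ ∪ ker χ₃`, then `|Γ| = 4` and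
`g ↦ (χ₁(g), χ₂(g), χ₃(g))` maps `Γ` bijectively onto
`{(1,1,1), (-1,-1,1), (-1,1,-1), (1,-1,-1)}`. -/
theorem klein_four_classification (Γ : Type*) [CommGroup Γ] [Fintype Γ] [Nontrivial Γ]
    (χ : Fin 3 → (Γ →* ℂˣ))
    (hprod : ∀ g : Γ, χ 0 g * χ 1 g * χ 2 g = 1)
    (hker : (χ 0).ker ⊓ (χ 1).ker ⊓ (χ 2).ker = ⊥)
    (hnt : ∀ k : Fin 3, χ k ≠ 1)
    (hcover : ∀ g : Γ, ∃ k : Fin 3, χ k g = 1) :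
    Fintype.card Γ = 4 ∧
      Function.Injective (fun g : Γ => ((χ 0 g : ℂ), (χ 1 g : ℂ), (χ 2 g : ℂ))) ∧
      Set.range (fun g : Γ => ((χ 0 g : ℂ), (χ 1 g : ℂ), (χ 2 g : ℂ)))
        = {((1 : ℂ), (1 : ℂ), (1 : ℂ)), (-1, -1, 1), (-1, 1, -1), (1, -1, -1)} := by
  have hprod₁ : ∀ g, χ 1 g * χ 2 g * χ 0 g = 1 := fun g => by
    rw [mul_comm, ← mul_assoc, hprod]
  have hprod₂ : ∀ g, χ 2 g * χ 0 g * χ 1 g = 1 := fun g => by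
    rw [mul_comm, ← mul_assoc, hprod₁]
  have hcover₀ : ∀ g, χ 0 g = 1 ∨ χ 1 g = 1 ∨ χ 2 g = 1 := fun g => by
    simpa [Fin.exists_fin_succ] using hcover g
  have hcover₁ : ∀ g, χ 1 g = 1 ∨ χ 2 g = 1 ∨ χ 0 g = 1 := fun g => by
    have := hcover₀ g
    tauto
  have hcover₂ : ∀ g, χ 2 g = 1 ∨ χ 0 g = 1 ∨ χ 1 g = 1 := fun g => by
    have := hcover₀ g
    tauto
  have val₀ : ∀ g, χ 0 g = 1 → χ 1 g ≠ 1 → χ 1 g = -1 ∧ χ 2 g = -1 := fun g h h' => by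
    have hb := (eq_one_or_eq_neg_one_of_cover hprod (hnt 0) (hnt 2) hcover₀ h).resolve_left h'
    have := hprod g
    rw [h, hb, one_mul, neg_one_mul, neg_eq_iff_eq_neg] at this
    exact ⟨hb, this⟩
  have val₁ : ∀ g, χ 1 g = 1 → χ 2 g ≠ 1 → χ 2 g = -1 ∧ χ 0 g = -1 := fun g h h' => by
    have hb := (eq_one_or_eq_neg_one_of_cover hprod₁ (hnt 1) (hnt 0) hcover₁ h).resolve_left h'
    have := hprod₁ g
    rw [h, hb, one_mul, neg_one_mul, neg_eq_iff_eq_neg] at this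
    exact ⟨hb, this⟩
  have val₂ : ∀ g, χ 2 g = 1 → χ 0 g ≠ 1 → χ 0 g = -1 ∧ χ 1 g = -1 := fun g h h' => by
    have hb := (eq_one_or_eq_neg_one_of_cover hprod₂ (hnt 2) (hnt 1) hcover₂ h).resolve_left h'
    have := hprod₂ g
    rw [h, hb, one_mul, neg_one_mul, neg_eq_iff_eq_neg] at this
    exact ⟨hb, this⟩
  have hinj : Function.Injective (fun g : Γ => ((χ 0 g : ℂ), (χ 1 g : ℂ), (χ 2 g : ℂ))) := by
    intro g h hgh
    simp only [Prod.mk.injEq, Units.val_inj] at hgh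
    have hmem : g / h ∈ (χ 0).ker ⊓ (χ 1).ker ⊓ (χ 2).ker := by
      simp [Subgroup.mem_inf, MonoidHom.mem_ker, hgh]
    rw [hker, Subgroup.mem_bot] at hmem
    exact div_eq_one.mp hmem
  have hrange : Set.range (fun g : Γ => ((χ 0 g : ℂ), (χ 1 g : ℂ), (χ 2 g : ℂ)))
      = {((1 : ℂ), (1 : ℂ), (1 : ℂ)), (-1, -1, 1), (-1, 1, -1), (1, -1, -1)} := by
    apply Set.Subset.antisymm
    · rintro _ ⟨g, rfl⟩
      by_cases h₀ : χ 0 g = 1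
      · by_cases h₁ : χ 1 g = 1
        · have h₂ : χ 2 g = 1 := by simpa [h₀, h₁] using hprod g
          simp [h₀, h₁, h₂]
        · simp [h₀, val₀ g h₀ h₁]
      · by_cases h₂ : χ 2 g = 1
        · simp [h₂, val₂ g h₂ h₀]
        · have h₁ : χ 1 g = 1 := by
            have := hcover₀ g
            tauto
          simp [h₁, val₁ g h₁ h₂]
    · obtain ⟨g₀, h₀, h₀'⟩ := exists_mem_ker_notMem_ker_of_cover (hnt 1) (hnt 2) hcover₀
      obtain ⟨g₁, h₁, h₁'⟩ := exists_mem_ker_notMem_ker_of_cover (hnt 2) (hnt 0) hcover₁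
      obtain ⟨g₂, h₂, h₂'⟩ := exists_mem_ker_notMem_ker_of_cover (hnt 0) (hnt 1) hcover₂
      rintro _ (rfl | rfl | rfl | rfl)
      · exact ⟨1, by simp⟩
      · exact ⟨g₂, by simp [h₂, val₂ g₂ h₂ h₂']⟩
      · exact ⟨g₁, by simp [h₁, val₁ g₁ h₁ h₁']⟩
      · exact ⟨g₀, by simp [h₀, val₀ g₀ h₀ h₀']⟩
  refine ⟨?_, hinj, hrange⟩
  have hne : (1 : ℂ) ≠ -1 := by norm_num
  rw [← Nat.card_eq_fintype_card, ← Set.ncard_range_of_injective hinj, hrange,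
    Set.ncard_insert_of_notMem (by simp [hne]),
    Set.ncard_insert_of_notMem (by simp [hne, hne.symm]),
    Set.ncard_pair (by simp [hne, hne.symm])]
end

section
/- Let Γ be a nontrivial finite abelian group and χ₁, χ₂, χ₃ : Γ → ℂ* group homomorphisms such that χ₁(g)χ₂(g)χ₃(g) = 1 for all g ∈ Γ, such that ker χ₁ ∩ ker χ₂ ∩ ker χ₃ = {1}, and such that each χ_k is nontrivial. Set Γ⁰ := {g ∈ Γ \ {1} : χ₁(g) ≠ 1, χ₂(g) ≠ 1 and χ₃(g) ≠ 1}, and for k = 1, 2, 3 put n_k := |ker χ_k|, ν_k := |im χ_k| and δ_k(Γ) := Σ_{g ∈ Γ⁰} χ_k(g)/(1 − χ_k(g))² (so δ_k(Γ) = 0 when Γ⁰ = ∅). Then for each k ∈ {1,2,3}: δ_k(Γ) = −(1/12)·( n_k(ν_k² − 1) + 2 − Σ_{l ≠ k} n_l² ). -/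
open scoped Classical

open Finset in
/-- Closed form of the sum `∑ j(N - j) z ^ j`, cleared of denominators. -/
lemma one_sub_pow_three_mul_sum_mul_sub_mul_pow {R : Type*} [CommRing R] (N z : R) (m : ℕ) :
    (1 - z) ^ 3 * ∑ j ∈ range m, (j : R) * (N - j) * z ^ j =
      ((1 - z) ^ 2 * m ^ 2 + (2 * z * (1 - z) - N * (1 - z) ^ 2) * m +
        z * (1 + z - N * (1 - z))) * z ^ m - z * (1 + z - N * (1 - z)) := by
  induction m with
  | zero => simp
  | succ m ih =>
    rw [sum_range_succ, mul_add, ih]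
    push_cast
    ring

open Finset in
/-- The finite Fourier expansion of `z / (1 - z) ^ 2` on nontrivial `n`-th roots of unity. -/
lemma sum_mul_sub_mul_pow_eq_of_pow_eq_one {K : Type*} [Field K] {n : ℕ} {z : K}
    (hz : z ≠ 1) (hn : z ^ n = 1) :
    ∑ j ∈ range n, (j : K) * (n - j) * z ^ j = 2 * n * (z / (1 - z) ^ 2) := by
  have h1 : 1 - z ≠ 0 := sub_ne_zero.mpr hz.symm
  have h := one_sub_pow_three_mul_sum_mul_sub_mul_pow (n : K) z n
  rw [hn] at h
  apply mul_left_cancel₀ (pow_ne_zero 3 h1)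
  rw [h]
  field_simp
  ring

open Finset in
lemma sum_range_mul_sub_self {K : Type*} [Field K] [CharZero K] (n : ℕ) :
    ∑ j ∈ range n, (j : K) * (n - j) = n * (n ^ 2 - 1) / 6 := by
  have key (N : K) (m : ℕ) : ∑ j ∈ range m, (j : K) * (N - j) =
      N * (m * (m - 1)) / 2 - m * (m - 1) * (2 * m - 1) / 6 := by
    induction m with
    | zero => simp
    | succ m ih =>
      rw [sum_range_succ, ih]
      push_cast
      ring
  rw [key]
  ring

/-- If `0 < j < |im φ|`, then the `j`-th power of `φ` is a nontrivial character. -/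
lemma MonoidHom.sum_pow_eq_zero_of_lt_card_range {G K : Type*} [CommGroup G] [Fintype G] [Field K]
    (φ : G →* Kˣ) {j : ℕ} (hj : j ≠ 0) (hlt : j < Nat.card φ.range) :
    ∑ g, (φ g : K) ^ j = 0 := by
  have hne : (Units.coeHom K).comp (φ ^ j) ≠ 1 := by
    intro h
    have hpow : ∀ x : φ.range, x ^ j = 1 := by
      rintro ⟨_, g, rfl⟩
      ext
      simpa using DFunLike.congr_fun h g
    have hdvd := Monoid.exponent_dvd_of_forall_pow_eq_one hpow
    rw [IsCyclic.exponent_eq_card] at hdvd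
    exact absurd (Nat.le_of_dvd (Nat.pos_of_ne_zero hj) hdvd) hlt.not_ge
  simpa using sum_hom_units_eq_zero _ hne

/-- The terms with `φ g = 1` vanish because of the convention `1 / 0 = 0`. -/
lemma MonoidHom.sum_div_one_sub_sq {G K : Type*} [CommGroup G] [Fintype G] [Field K] [CharZero K]
    (φ : G →* Kˣ) :
    ∑ g, (φ g : K) / (1 - (φ g : K)) ^ 2 =
      -(1 / 12) * ((Nat.card φ.ker : K) * ((Nat.card φ.range : K) ^ 2 - 1)) := by
  set n := Nat.card φ.range with hn
  have hn0 : (n : K) ≠ 0 := Nat.cast_ne_zero.mpr Nat.card_pos.ne'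
  have hpow (g : G) : (φ g : K) ^ n = 1 := by
    have h : (⟨φ g, g, rfl⟩ : φ.range) ^ n = 1 := pow_card_eq_one'
    simpa using congrArg (fun x : φ.range => ((x : Kˣ) : K)) h
  have hterm (g : G) : 2 * (n : K) * ((φ g : K) / (1 - (φ g : K)) ^ 2) =
      ∑ j ∈ Finset.range n, (j : K) * (n - j) * (φ g : K) ^ j -
        if g ∈ φ.ker then (n : K) * (n ^ 2 - 1) / 6 else 0 := by
    by_cases hg : φ g = 1
    · simp [MonoidHom.mem_ker, hg, sum_range_mul_sub_self]
    · rw [sum_mul_sub_mul_pow_eq_of_pow_eq_one (by simpa using hg) (hpow g)]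
      simp [MonoidHom.mem_ker, hg]
  have hzero : ∑ g, ∑ j ∈ Finset.range n, (j : K) * (n - j) * (φ g : K) ^ j = 0 := by
    rw [Finset.sum_comm]
    refine Finset.sum_eq_zero fun j hj => ?_
    rw [← Finset.mul_sum]
    rcases eq_or_ne j 0 with rfl | hj0
    · simp
    · rw [φ.sum_pow_eq_zero_of_lt_card_range hj0 (Finset.mem_range.mp hj), mul_zero]
  have hcard : ∑ g, (if g ∈ φ.ker then (n : K) * (n ^ 2 - 1) / 6 else 0) =
      Nat.card φ.ker * ((n : K) * (n ^ 2 - 1) / 6) := by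
    rw [← Finset.sum_filter, Finset.sum_const, nsmul_eq_mul, Nat.card_eq_fintype_card,
      Fintype.card_subtype]
  apply mul_left_cancel₀ (mul_ne_zero two_ne_zero hn0)
  rw [Finset.mul_sum, Finset.sum_congr rfl fun g _ => hterm g, Finset.sum_sub_distrib, hzero,
    hcard]
  field_simp
  ring

lemma MonoidHom.sum_ker_div_one_sub_sq {G K : Type*} [CommGroup G] [Fintype G] [Field K]
    [CharZero K] (φ ψ : G →* Kˣ) (h : φ.ker ⊓ ψ.ker = ⊥) :
    ∑ g, (if ψ g = 1 then (φ g : K) / (1 - (φ g : K)) ^ 2 else 0) =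
      -(1 / 12) * ((Nat.card ψ.ker : K) ^ 2 - 1) := by
  have hinj : Function.Injective (φ.comp ψ.ker.subtype) := by
    rw [injective_iff_map_eq_one]
    rintro ⟨g, hg⟩ hφ
    have : g ∈ φ.ker ⊓ ψ.ker := ⟨hφ, hg⟩
    rw [h, Subgroup.mem_bot] at this
    exact Subtype.ext this
  have hsum := (φ.comp ψ.ker.subtype).sum_div_one_sub_sq
  rw [(MonoidHom.ker_eq_bot_iff _).mpr hinj, Subgroup.card_bot,
    ← Nat.card_congr (MonoidHom.ofInjective hinj).toEquiv, Nat.cast_one, one_mul] at hsum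
  rw [← hsum, ← Finset.sum_filter]
  exact Finset.sum_subtype _ (fun g => by simp [MonoidHom.mem_ker])
    (fun g => (φ g : K) / (1 - (φ g : K)) ^ 2)

lemma MonoidHom.sum_mem_div_one_sub_sq {G K : Type*} [CommGroup G] [Fintype G] [Field K]
    [CharZero K] (φ ψ θ : G →* Kˣ) (hprod : ∀ g, φ g * ψ g * θ g = 1)
    (hker : φ.ker ⊓ ψ.ker ⊓ θ.ker = ⊥) (s : Finset G)
    (hs : ∀ g, g ∈ s ↔ φ g ≠ 1 ∧ ψ g ≠ 1 ∧ θ g ≠ 1) :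
    ∑ g ∈ s, (φ g : K) / (1 - (φ g : K)) ^ 2 =
      -(1 / 12) * ((Nat.card φ.ker : K) * ((Nat.card φ.range : K) ^ 2 - 1) + 2 -
        ((Nat.card ψ.ker : K) ^ 2 + (Nat.card θ.ker : K) ^ 2)) := by
  have hψ : φ.ker ⊓ ψ.ker = ⊥ := by
    rw [← hker, eq_comm, inf_eq_left]
    rintro g ⟨h1, h2⟩
    have := hprod g
    rwa [MonoidHom.mem_ker.mp h1, MonoidHom.mem_ker.mp h2, one_mul, one_mul] at this
  have hθ : φ.ker ⊓ θ.ker = ⊥ := by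
    rw [eq_bot_iff, ← hker]
    rintro g ⟨h1, h2⟩
    have := hprod g
    rw [MonoidHom.mem_ker.mp h1, MonoidHom.mem_ker.mp h2, one_mul, mul_one] at this
    exact ⟨⟨h1, this⟩, h2⟩
  have hsplit : ∑ g ∈ s, (φ g : K) / (1 - (φ g : K)) ^ 2 =
      ∑ g, (φ g : K) / (1 - (φ g : K)) ^ 2 -
        ∑ g, (if ψ g = 1 then (φ g : K) / (1 - (φ g : K)) ^ 2 else 0) -
        ∑ g, (if θ g = 1 then (φ g : K) / (1 - (φ g : K)) ^ 2 else 0) := by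
    rw [← Finset.filter_univ_mem s, Finset.sum_filter, ← Finset.sum_sub_distrib,
      ← Finset.sum_sub_distrib]
    refine Finset.sum_congr rfl fun g _ => ?_
    have := hprod g
    simp only [hs]
    by_cases h1 : φ g = 1
    · simp [h1]
    · by_cases h2 : ψ g = 1 <;> by_cases h3 : θ g = 1 <;> simp_all
  rw [hsplit, φ.sum_div_one_sub_sq, φ.sum_ker_div_one_sub_sq ψ hψ,
    φ.sum_ker_div_one_sub_sq θ hθ]
  ring

/-- Evaluation of the Dedekind-type sums `δ_k(Γ)`: with `Γ⁰ = {g ∈ Γ\{1} : χ_j(g) ≠ 1 ∀j}`,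
`n_k = |ker χ_k|` and `ν_k = |im χ_k|`, one has
`δ_k(Γ) = -(1/12)(n_k(ν_k² - 1) + 2 - ∑_{l ≠ k} n_l²)`. -/
theorem delta_k_eval (Γ : Type*) [CommGroup Γ] [Fintype Γ] [Nontrivial Γ]
    (χ : Fin 3 → (Γ →* ℂˣ))
    (hprod : ∀ g : Γ, χ 0 g * χ 1 g * χ 2 g = 1)
    (hker : (χ 0).ker ⊓ (χ 1).ker ⊓ (χ 2).ker = ⊥)
    (hnt : ∀ k : Fin 3, χ k ≠ 1) :
    ∀ k : Fin 3,
      ∑ g ∈ Finset.univ.filter (fun g : Γ => g ≠ 1 ∧ ∀ j : Fin 3, χ j g ≠ 1),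
          (χ k g : ℂ) / (1 - (χ k g : ℂ)) ^ 2
        = -(1 / 12) * ((Nat.card (MonoidHom.ker (χ k)) : ℂ) *
              ((Nat.card (MonoidHom.range (χ k)) : ℂ) ^ 2 - 1) + 2 -
            ∑ l ∈ Finset.univ.filter (fun l : Fin 3 => l ≠ k),
              (Nat.card (MonoidHom.ker (χ l)) : ℂ) ^ 2) := by
  have hmem (g : Γ) : g ∈ Finset.univ.filter (fun g : Γ => g ≠ 1 ∧ ∀ j : Fin 3, χ j g ≠ 1) ↔
      χ 0 g ≠ 1 ∧ χ 1 g ≠ 1 ∧ χ 2 g ≠ 1 := by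
    simp only [Finset.mem_filter, Finset.mem_univ, true_and, Fin.forall_fin_succ]
    constructor
    · rintro ⟨-, h0, h1, h2, -⟩
      exact ⟨h0, h1, h2⟩
    · rintro ⟨h0, h1, h2⟩
      exact ⟨fun h => h0 (by rw [h, map_one]), h0, h1, h2, fun i => i.elim0⟩
  intro k
  rw [Finset.sum_filter (fun l : Fin 3 => l ≠ k), Fin.sum_univ_three]
  match k with
  | 0 =>
    rw [(χ 0).sum_mem_div_one_sub_sq (χ 1) (χ 2) hprod hker _ hmem]
    simp
  | 1 =>
    rw [(χ 1).sum_mem_div_one_sub_sq (χ 0) (χ 2)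
      (fun g => by rw [mul_comm (χ 1 g), hprod]) (by rw [inf_comm (χ 1).ker, hker]) _
      (fun g => by rw [hmem]; tauto)]
    simp
  | 2 =>
    rw [(χ 2).sum_mem_div_one_sub_sq (χ 0) (χ 1)
      (fun g => by rw [mul_assoc, mul_comm, hprod]) (by rw [inf_assoc, inf_comm, hker]) _
      (fun g => by rw [hmem]; tauto)]
    simp
end
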